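/- Let λ, λ′ > 0 and let p, p′ : ℕ → ℝ be probability mass functions with p(0) = p′(0) = 0 such that p′(i) > 0 whenever p(i) > 0 and KL(p^{∗n}, p′^{∗n}) is finite for all n. Let q(i) = ∑_{n=0}^∞ e^{−λ} (λⁿ/n!) p^{∗n}(i) and q′(i) = ∑_{n=0}^∞ e^{−λ′} (λ′ⁿ/n!) p′^{∗n}(i). Then KL(q, q′) ≤ ∑_{n=0}^∞ e^{−λ} (λⁿ/n!) · KL(p^{∗n}, p′^{∗n}) + KL(Poisson(λ), Poisson(λ′)), where KL(Poisson(λ), Poisson(λ′)) = ∑_{n=0}^∞ e^{−λ}(λⁿ/n!) log((e^{−λ}λⁿ)/(e^{−λ′}λ′ⁿ)) = λ′ − λ + λ log(λ/λ′). -/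

import Mathlib

open MeasureTheory
open scoped BigOperators Classical

noncomputable section

/-- Discrete convolution of two sequences. -/
def conv (a b : ℕ → ℝ) : ℕ → ℝ := fun i => ∑ k ∈ Finset.range (i + 1), a k * b (i - k)

/-- The sequence δ₀ with δ₀(0) = 1 and δ₀(k) = 0 for k ≥ 1. -/
def delta0 : ℕ → ℝ := fun i => if i = 0 then 1 else 0

/-- Convolution powers: a^{∗0} = δ₀, a^{∗(n+1)} = a^{∗n} ∗ a. -/
def convPow (a : ℕ → ℝ) : ℕ → ℕ → ℝ
  | 0 => delta0
  | n + 1 => conv (convPow a n) a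

/-- The ℓ¹ norm of a sequence. -/
def l1 (a : ℕ → ℝ) : ℝ := ∑' i, |a i|

/-- exp(a) = ∑_{j=0}^∞ a^{∗j}/j!, defined coordinatewise. -/
def expSeq (a : ℕ → ℝ) : ℕ → ℝ := fun i => ∑' j, convPow a j i / (Nat.factorial j : ℝ)

/-- p is a probability mass function on ℕ₀. -/
def IsPMF (p : ℕ → ℝ) : Prop := (∀ i, 0 ≤ p i) ∧ ∑' i, p i = 1

/-- Kullback–Leibler divergence. -/
def KL (u v : ℕ → ℝ) : ℝ := ∑' i, u i * Real.log (u i / v i)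

/-- The V divergence. -/
def Vd (u v : ℕ → ℝ) : ℝ := ∑' i, u i * (Real.log (u i / v i)) ^ 2

/-- Squared Hellinger distance. -/
def hellSq (u v : ℕ → ℝ) : ℝ := ∑' i, (Real.sqrt (u i) - Real.sqrt (v i)) ^ 2

/-- Hellinger distance. -/
def hell (u v : ℕ → ℝ) : ℝ := Real.sqrt (hellSq u v)

/-- The compound Poisson distribution of (λ, p). -/
def cpq (lam : ℝ) (p : ℕ → ℝ) : ℕ → ℝ :=
  fun i => ∑' n, Real.exp (-lam) * lam ^ n / (Nat.factorial n : ℝ) * convPow p n i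

/-- The nonnegative pointwise divergence whose sum over the support of two mass functions is `KL`. -/
def klTerm (x y : ℝ) : ℝ := x * Real.log (x / y) - x + y

lemma klTerm_ge {x y t : ℝ} (hx : 0 ≤ x) (hy : 0 ≤ y) (hxy : y = 0 → x = 0) (ht : 0 < t) :
    x * Real.log t + y - y * t ≤ klTerm x y := by
  unfold klTerm
  rcases hx.eq_or_lt with rfl | hx
  · simp
    positivity
  · have hy' : 0 < y := hy.lt_of_ne fun h => hx.ne' (hxy h.symm)
    have h := Real.log_le_sub_one_of_pos (show 0 < y * t / x by positivity)
    have hlog : Real.log (y * t / x) = Real.log t - Real.log (x / y) := by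
      rw [Real.log_div (by positivity) hx.ne', Real.log_mul hy'.ne' ht.ne',
        Real.log_div hx.ne' hy'.ne']
      ring
    rw [hlog] at h
    have h2 := mul_le_mul_of_nonneg_left h hx.le
    have h3 : x * (y * t / x - 1) = y * t - x := by field_simp
    rw [h3] at h2
    linarith

lemma klTerm_nonneg {x y : ℝ} (hx : 0 ≤ x) (hy : 0 ≤ y) (hxy : y = 0 → x = 0) :
    0 ≤ klTerm x y := by
  simpa using klTerm_ge hx hy hxy one_pos

/-- The log-sum inequality. -/
lemma klTerm_le_of_hasSum {ι : Type*} {x y : ι → ℝ} {X Y Z : ℝ} (hx : ∀ j, 0 ≤ x j)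
    (hy : ∀ j, 0 ≤ y j) (hxy : ∀ j, y j = 0 → x j = 0) (hX : HasSum x X) (hY : HasSum y Y)
    (hZ : HasSum (fun j => klTerm (x j) (y j)) Z) : klTerm X Y ≤ Z := by
  have key : ∀ t : ℝ, 0 < t → X * Real.log t + Y - Y * t ≤ Z := fun t ht =>
    hasSum_le (fun j => klTerm_ge (hx j) (hy j) (hxy j) ht)
      (((hX.mul_right _).add hY).sub (hY.mul_right t)) hZ
  rcases (hX.nonneg hx).eq_or_lt with h0 | h0
  · subst h0
    have hx0 : x = 0 := (hasSum_zero_iff_of_nonneg hx).1 hX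
    have hYZ : Y = Z := by
      refine hY.unique ?_
      simpa [klTerm, hx0] using hZ
    simp [klTerm, hYZ]
  · have hY0 : 0 < Y := by
      refine (hY.nonneg hy).lt_of_ne fun h => ?_
      subst h
      have hy0 : y = 0 := (hasSum_zero_iff_of_nonneg hy).1 hY
      have hx0 : x = 0 := funext fun j => hxy j (congrFun hy0 j)
      rw [hx0] at hX
      exact h0.ne (hX.unique hasSum_zero).symm
    have h := key (X / Y) (by positivity)
    rw [mul_div_cancel₀ _ hY0.ne'] at h
    unfold klTerm
    linarith

lemma klTerm_mul {a a' b b' : ℝ} (ha : a' = 0 → a = 0) (hb : b' = 0 → b = 0) :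
    klTerm (a * b) (a' * b') =
      a * Real.log (a / a') * b + a * (b * Real.log (b / b')) - a * b + a' * b' := by
  unfold klTerm
  by_cases ha0 : a = 0
  · simp [ha0]
  by_cases hb0 : b = 0
  · simp [hb0]
  have ha' : a' ≠ 0 := fun h => ha0 (ha h)
  have hb' : b' ≠ 0 := fun h => hb0 (hb h)
  rw [mul_div_mul_comm, Real.log_mul (div_ne_zero ha0 ha') (div_ne_zero hb0 hb')]
  ring

lemma hasSum_tsum_swap {F : ℕ → ℕ → ℝ} {s : ℕ → ℝ} {S : ℝ} (hF : ∀ n i, 0 ≤ F n i)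
    (hs : ∀ n, HasSum (F n) (s n)) (hS : HasSum s S) :
    (∀ i, Summable fun n => F n i) ∧ HasSum (fun i => ∑' n, F n i) S := by
  have hsum : Summable fun z : ℕ × ℕ => F z.1 z.2 := by
    refine (summable_prod_of_nonneg fun z => hF z.1 z.2).2 ⟨fun n => (hs n).summable, ?_⟩
    simpa only [(hs _).tsum_eq] using hS.summable
  have htot : HasSum (fun z : ℕ × ℕ => F z.1 z.2) S := by
    have h := hsum.hasSum
    rwa [(h.prod_fiberwise hs).unique hS] at h
  have hswap : HasSum (fun z : ℕ × ℕ => F z.2 z.1) S :=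
    (Equiv.prodComm ℕ ℕ).hasSum_iff.2 htot
  have hcol : ∀ i, Summable fun n => F n i := fun i => hswap.summable.prod_factor i
  exact ⟨hcol, hswap.prod_fiberwise fun i => (hcol i).hasSum⟩

lemma hasSum_conv {a b : ℕ → ℝ} {A B : ℝ} (ha : HasSum a A) (hb : HasSum b B) :
    HasSum (conv a b) (A * B) := by
  have h := hasSum_sum_range_mul_of_summable_norm ha.summable.norm hb.summable.norm
  rwa [ha.tsum_eq, hb.tsum_eq] at h

lemma conv_nonneg {a b : ℕ → ℝ} (ha : ∀ i, 0 ≤ a i) (hb : ∀ i, 0 ≤ b i) (i : ℕ) :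
    0 ≤ conv a b i :=
  Finset.sum_nonneg fun _ _ => mul_nonneg (ha _) (hb _)

lemma conv_eq_zero_of_eq_zero {a a' b b' : ℕ → ℝ} (ha' : ∀ i, 0 ≤ a' i) (hb' : ∀ i, 0 ≤ b' i)
    (ha : ∀ i, a' i = 0 → a i = 0) (hb : ∀ i, b' i = 0 → b i = 0) (i : ℕ)
    (h : conv a' b' i = 0) : conv a b i = 0 := by
  rw [conv, Finset.sum_eq_zero_iff_of_nonneg fun _ _ => mul_nonneg (ha' _) (hb' _)] at h
  refine Finset.sum_eq_zero fun k hk => ?_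
  rcases mul_eq_zero.1 (h k hk) with h | h
  · rw [ha _ h, zero_mul]
  · rw [hb _ h, mul_zero]

lemma IsPMF.hasSum {p : ℕ → ℝ} (hp : IsPMF p) : HasSum p 1 := by
  have hs : Summable p := by
    by_contra h
    have := hp.2
    rw [tsum_eq_zero_of_not_summable h] at this
    exact zero_ne_one this
  simpa [hp.2] using hs.hasSum

lemma isPMF_convPow {p : ℕ → ℝ} (hp : IsPMF p) (n : ℕ) : IsPMF (convPow p n) := by
  induction n with
  | zero =>
    refine ⟨fun i => ?_, ?_⟩
    · simp only [convPow, delta0]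
      split_ifs <;> norm_num
    · simp [convPow, delta0]
  | succ n ih =>
    refine ⟨conv_nonneg ih.1 hp.1, ?_⟩
    exact (hasSum_conv ih.hasSum hp.hasSum).tsum_eq.trans (one_mul 1)

lemma convPow_eq_zero_of_eq_zero {p p' : ℕ → ℝ} (hp' : IsPMF p')
    (habs : ∀ i, p' i = 0 → p i = 0) (n i : ℕ) (h : convPow p' n i = 0) :
    convPow p n i = 0 := by
  induction n generalizing i with
  | zero => exact h
  | succ n ih =>
    exact conv_eq_zero_of_eq_zero (isPMF_convPow hp' n).1 hp'.1 ih habs i h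

lemma hasSum_klTerm {u v : ℕ → ℝ} (hu : HasSum u 1) (hv : HasSum v 1)
    (h : Summable fun i => u i * Real.log (u i / v i)) :
    HasSum (fun i => klTerm (u i) (v i)) (KL u v) := by
  have := (h.hasSum.sub hu).add hv
  rwa [sub_add_cancel] at this

lemma KL_le_of_klTerm_le {u v : ℕ → ℝ} {F : ℕ → ℝ} {S : ℝ} (hu : HasSum u 1) (hv : HasSum v 1)
    (hnn : ∀ i, 0 ≤ klTerm (u i) (v i)) (hle : ∀ i, klTerm (u i) (v i) ≤ F i)
    (hF : HasSum F S) : KL u v ≤ S := by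
  have hs : Summable fun i => klTerm (u i) (v i) := Summable.of_nonneg_of_le hnn hle hF.summable
  have hs' : Summable fun i => u i * Real.log (u i / v i) := by
    refine ((hs.add hu.summable).sub hv.summable).congr fun i => ?_
    unfold klTerm
    ring
  exact hasSum_le hle (hasSum_klTerm hu hv hs') hF

lemma KL_nonneg {u v : ℕ → ℝ} (hu : IsPMF u) (hv : IsPMF v) (huv : ∀ i, v i = 0 → u i = 0)
    (h : Summable fun i => u i * Real.log (u i / v i)) : 0 ≤ KL u v :=
  (hasSum_klTerm hu.hasSum hv.hasSum h).nonneg fun i => klTerm_nonneg (hu.1 i) (hv.1 i) (huv i)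

/-- Subadditivity of the Kullback–Leibler divergence under convolution. -/
lemma KL_conv_le {a a' b b' : ℕ → ℝ} (ha : IsPMF a) (ha' : IsPMF a') (hb : IsPMF b)
    (hb' : IsPMF b') (haa : ∀ i, a' i = 0 → a i = 0) (hbb : ∀ i, b' i = 0 → b i = 0)
    (hsa : Summable fun i => a i * Real.log (a i / a' i))
    (hsb : Summable fun i => b i * Real.log (b i / b' i)) :
    KL (conv a b) (conv a' b') ≤ KL a a' + KL b b' := by
  have hu := hasSum_conv ha.hasSum hb.hasSum
  have hv := hasSum_conv ha'.hasSum hb'.hasSum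
  have hF := (((hasSum_conv hsa.hasSum hb.hasSum).add (hasSum_conv ha.hasSum hsb.hasSum)).sub
    hu).add hv
  rw [mul_one, one_mul, mul_one, sub_add_cancel] at hF
  rw [mul_one] at hu hv
  refine KL_le_of_klTerm_le hu hv (fun i => klTerm_nonneg (conv_nonneg ha.1 hb.1 i)
    (conv_nonneg ha'.1 hb'.1 i) (conv_eq_zero_of_eq_zero ha'.1 hb'.1 haa hbb i)) (fun i => ?_) hF
  simp only [conv, ← Finset.sum_add_distrib, ← Finset.sum_sub_distrib]
  simp only [Finset.sum_range]
  refine klTerm_le_of_hasSum (fun j => mul_nonneg (ha.1 _) (hb.1 _))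
    (fun j => mul_nonneg (ha'.1 _) (hb'.1 _)) (fun j h => ?_) (hasSum_fintype _)
    (hasSum_fintype _) ?_
  · rcases mul_eq_zero.1 h with h | h
    · rw [haa _ h, zero_mul]
    · rw [hbb _ h, mul_zero]
  · simp only [klTerm_mul (haa _) (hbb _)]
    exact hasSum_fintype _

/-- The mass `e^{-λ} λⁿ / n!` of the Poisson distribution. -/
def poissonMass (lam : ℝ) (n : ℕ) : ℝ := Real.exp (-lam) * lam ^ n / (Nat.factorial n : ℝ)

lemma poissonMass_pos {lam : ℝ} (hl : 0 < lam) (n : ℕ) : 0 < poissonMass lam n := by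
  unfold poissonMass
  positivity

lemma hasSum_poissonMass (lam : ℝ) : HasSum (poissonMass lam) 1 := by
  have h := (NormedSpace.expSeries_div_hasSum_exp lam).mul_left (Real.exp (-lam))
  rw [← Real.exp_eq_exp_ℝ, ← Real.exp_add, neg_add_cancel, Real.exp_zero] at h
  exact h.congr_fun fun n => mul_div_assoc _ _ _

lemma hasSum_poissonMass_mul_id (lam : ℝ) : HasSum (fun n : ℕ => poissonMass lam n * n) lam := by
  rw [← hasSum_nat_add_iff' 1]
  have h := (hasSum_poissonMass lam).mul_left lam
  simp only [Finset.range_one, Finset.sum_singleton, Nat.cast_zero, mul_zero, sub_zero]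
  rw [mul_one] at h
  refine h.congr_fun fun n => ?_
  simp only [poissonMass, Nat.factorial_succ, pow_succ]
  have : (Nat.factorial n : ℝ) ≠ 0 := by positivity
  push_cast
  field_simp

lemma hasSum_poissonMass_mul_log {lam lam' : ℝ} (hl : 0 < lam) (hl' : 0 < lam') :
    HasSum (fun n => poissonMass lam n * Real.log (poissonMass lam n / poissonMass lam' n))
      (lam' - lam + lam * Real.log (lam / lam')) := by
  have h := ((hasSum_poissonMass lam).mul_right (lam' - lam)).add
    ((hasSum_poissonMass_mul_id lam).mul_right (Real.log (lam / lam')))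
  rw [one_mul] at h
  refine h.congr_fun fun n => ?_
  have hq : poissonMass lam n / poissonMass lam' n =
      Real.exp (lam' - lam) * (lam / lam') ^ n := by
    have : (Nat.factorial n : ℝ) ≠ 0 := by positivity
    have he : Real.exp (lam' - lam) = Real.exp (-lam) / Real.exp (-lam') := by
      rw [← Real.exp_sub]
      ring_nf
    rw [he, div_pow, poissonMass, poissonMass]
    field_simp
  rw [hq, Real.log_mul (Real.exp_ne_zero _) (by positivity), Real.log_exp, Real.log_pow]
  ring

lemma hasSum_poissonMass_mul_convPow {lam : ℝ} (hl : 0 < lam) {p : ℕ → ℝ} (hp : IsPMF p) :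
    (∀ i, Summable fun n => poissonMass lam n * convPow p n i) ∧ HasSum (cpq lam p) 1 :=
  hasSum_tsum_swap
    (fun n i => mul_nonneg (poissonMass_pos hl n).le ((isPMF_convPow hp n).1 i))
    (fun n => by simpa using (isPMF_convPow hp n).hasSum.mul_left (poissonMass lam n))
    (hasSum_poissonMass lam)

/-- KL(q, q′) ≤ ∑_n e^{−λ}(λⁿ/n!)·KL(p^{∗n}, p′^{∗n}) + KL(Poisson(λ), Poisson(λ′)),
with KL(Poisson(λ), Poisson(λ′)) = λ′ − λ + λ log(λ/λ′). -/
theorem stmt13 (lam lam' : ℝ) (hl : 0 < lam) (hl' : 0 < lam')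
    (p p' : ℕ → ℝ) (hp : IsPMF p) (hp' : IsPMF p') (h0 : p 0 = 0) (h0' : p' 0 = 0)
    (habs : ∀ i, 0 < p i → 0 < p' i)
    (hKL : ∀ n : ℕ, Summable fun i =>
      convPow p n i * Real.log (convPow p n i / convPow p' n i)) :
    KL (cpq lam p) (cpq lam' p') ≤
      (∑' n : ℕ, Real.exp (-lam) * lam ^ n / (Nat.factorial n : ℝ) *
        KL (convPow p n) (convPow p' n)) +
      (lam' - lam + lam * Real.log (lam / lam')) := by
  have habs' : ∀ i, p' i = 0 → p i = 0 := fun i h => by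
    by_contra hne
    exact (habs i ((hp.1 i).lt_of_ne' hne)).ne' h
  have hac := convPow_eq_zero_of_eq_zero hp' habs'
  have hpn := isPMF_convPow hp
  have hpn' := isPMF_convPow hp'
  have hKL1 : Summable fun i => p i * Real.log (p i / p' i) := by
    have hone : ∀ r : ℕ → ℝ, convPow r 1 = r := fun r => by
      ext i
      simp only [convPow, conv, delta0]
      rw [Finset.sum_eq_single 0 (by intro k _ hk; simp [hk]) (by simp)]
      simp
    simpa only [hone] using hKL 1
  have hKLn : ∀ n : ℕ, KL (convPow p n) (convPow p' n) ≤ n * KL p p' := by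
    intro n
    induction n with
    | zero => simp [KL, convPow, delta0]
    | succ n ih =>
      have h := KL_conv_le (hpn n) (hpn' n) hp hp' (hac n) habs' (hKL n) hKL1
      push_cast
      simp only [convPow]
      linarith
  have hsumKL : Summable fun n => poissonMass lam n * KL (convPow p n) (convPow p' n) := by
    refine Summable.of_nonneg_of_le (fun n => mul_nonneg (poissonMass_pos hl n).le
      (KL_nonneg (hpn n) (hpn' n) (hac n) (hKL n)))
      (fun n => mul_le_mul_of_nonneg_left (hKLn n) (poissonMass_pos hl n).le) ?_
    simpa only [mul_assoc] using
      (hasSum_poissonMass_mul_id lam).summable.mul_right (KL p p')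
  have hw0 : ∀ n, poissonMass lam' n = 0 → poissonMass lam n = 0 :=
    fun n h => absurd h (poissonMass_pos hl' n).ne'
  have hf : ∀ n i, 0 ≤ poissonMass lam n * convPow p n i :=
    fun n i => mul_nonneg (poissonMass_pos hl n).le ((hpn n).1 i)
  have hg : ∀ n i, 0 ≤ poissonMass lam' n * convPow p' n i :=
    fun n i => mul_nonneg (poissonMass_pos hl' n).le ((hpn' n).1 i)
  have hfg : ∀ n i, poissonMass lam' n * convPow p' n i = 0 →
      poissonMass lam n * convPow p n i = 0 := fun n i h => by
    rw [hac n i ((mul_eq_zero.1 h).resolve_left (poissonMass_pos hl' n).ne'), mul_zero]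
  have hrow : ∀ n, HasSum
      (fun i => klTerm (poissonMass lam n * convPow p n i) (poissonMass lam' n * convPow p' n i))
      (poissonMass lam n * Real.log (poissonMass lam n / poissonMass lam' n) +
        poissonMass lam n * KL (convPow p n) (convPow p' n) -
        poissonMass lam n + poissonMass lam' n) := by
    intro n
    simp only [fun i => klTerm_mul (hw0 n) (hac n i)]
    simpa only [mul_one, KL] using ((((hpn n).hasSum.mul_left
      (poissonMass lam n * Real.log (poissonMass lam n / poissonMass lam' n))).add
      ((hKL n).hasSum.mul_left (poissonMass lam n))).sub
      ((hpn n).hasSum.mul_left (poissonMass lam n))).add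
      ((hpn' n).hasSum.mul_left (poissonMass lam' n))
  have htot := (((hasSum_poissonMass_mul_log hl hl').add hsumKL.hasSum).sub
    (hasSum_poissonMass lam)).add (hasSum_poissonMass lam')
  rw [sub_add_cancel, add_comm] at htot
  obtain ⟨hcol, hS⟩ := hasSum_tsum_swap
    (fun n i => klTerm_nonneg (hf n i) (hg n i) (hfg n i)) hrow htot
  obtain ⟨hq, hq1⟩ := hasSum_poissonMass_mul_convPow hl hp
  obtain ⟨hq', hq1'⟩ := hasSum_poissonMass_mul_convPow hl' hp'
  refine KL_le_of_klTerm_le hq1 hq1' (fun i => klTerm_nonneg (tsum_nonneg fun n => hf n i)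
    (tsum_nonneg fun n => hg n i) fun h => ?_) (fun i => ?_) hS
  · have h0 := (hasSum_zero_iff_of_nonneg fun n => hg n i).1 ((hq' i).hasSum_iff.2 h)
    exact (tsum_congr fun n => hfg n i (congrFun h0 n)).trans tsum_zero
  · exact klTerm_le_of_hasSum (fun n => hf n i) (fun n => hg n i) (fun n => hfg n i)
      (hq i).hasSum (hq' i).hasSum (hcol i).hasSum
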